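/- Abstraction is a linear isomorphism for the semantic λ-calculus: define app1 : term X → term (Option X) by app1 x := app (shift x) (var none). Then for all x : term X, abs (app1 x) ≡ x (the η-rule), and for all t : term (Option X), app1 (abs t) ≡ t (a form of the β-rule). Consequently the induced maps on the quotients, abs̄ : Λ (Option X) → Λ X and app1̄ : Λ X → Λ (Option X), are mutually inverse bijections; moreover both are Λ-linear: for all f : X → term Y, abs (subst (comm f) t) ≡ subst f (abs t) and app1 (subst f x) ≡ subst (comm f) (app1 x), so abs̄ is an isomorphism of left Λ-modules from the derived module Λ' to Λ. -/

import Mathlib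

universe u

/-- Untyped λ-terms with free variables in `X`, in the nested-datatype
(locally nameless / de Bruijn) encoding. -/
inductive term : Type u → Type (u + 1)
  | var {X : Type u} : X → term X
  | app {X : Type u} : term X → term X → term X
  | abs {X : Type u} : term (Option X) → term X

/-- Renaming of free variables. -/
def fct {X Y : Type u} (f : X → Y) : term X → term Y
  | .var x => .var (f x)
  | .app t u => .app (fct f t) (fct f u)
  | .abs t => .abs (fct (Option.map f) t)

/-- Weakening. -/
def shift {X : Type u} (t : term X) : term (Option X) :=
  fct some t

def tcomm {X Y : Type u} (f : X → term Y) : Option X → term (Option Y)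
  | some a => shift (f a)
  | none => .var none

/-- Simultaneous substitution of free variables. -/
def subst {X Y : Type u} (f : X → term Y) : term X → term Y
  | .var x => f x
  | .app t u => .app (subst f t) (subst f u)
  | .abs t => .abs (subst (tcomm f) t)

/-- The map sending `none` to `u` and `some a` to `var a`;
`t[u] := subst (sub1 u) t`. -/
def sub1 {X : Type u} (u : term X) : Option X → term X
  | none => u
  | some a => .var a

/-- βη-equivalence on λ-terms. -/
inductive lcr : {X : Type u} → term X → term X → Prop
  | var {X : Type u} (a : X) : lcr (.var a) (.var a)
  | app {X : Type u} {x₁ x₂ y₁ y₂ : term X} :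
      lcr x₁ x₂ → lcr y₁ y₂ → lcr (.app x₁ y₁) (.app x₂ y₂)
  | abs {X : Type u} {x y : term (Option X)} : lcr x y → lcr (.abs x) (.abs y)
  | beta {X : Type u} (t : term (Option X)) (u : term X) :
      lcr (.app (.abs t) u) (subst (sub1 u) t)
  | eta {X : Type u} (t : term X) : lcr (.abs (.app (shift t) (.var none))) t
  | sym {X : Type u} {x y : term X} : lcr y x → lcr x y
  | trans {X : Type u} {x y z : term X} : lcr x y → lcr y z → lcr x z

/-- The semantic λ-calculus: λ-terms modulo βη-equivalence. -/
def Lam (X : Type u) : Type (u + 1) := Quot (@lcr.{u} X)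

def lmk {X : Type u} : term X → Lam X := Quot.mk _

/-- `app1 x := app (shift x) (var none)`, the inverse of abstraction up to
βη-equivalence. -/
def app1 {X : Type u} (x : term X) : term (Option X) :=
  .app (shift x) (.var none)

theorem lcr.refl {X : Type u} (t : term X) : lcr t t := by
  induction t with
  | var x => exact .var x
  | app _ _ iht ihu => exact .app iht ihu
  | abs _ ih => exact .abs ih

theorem fct_fct {X Y Z : Type u} (f : X → Y) (g : Y → Z) (t : term X) :
    fct g (fct f t) = fct (g ∘ f) t := by
  induction t generalizing Y Z with
  | var x => rfl
  | app t u iht ihu => simp only [fct, iht, ihu]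
  | abs t ih => simp only [fct, ih, Option.map_comp_map]

theorem subst_fct {X Y Z : Type u} (f : X → Y) (g : Y → term Z) (t : term X) :
    subst g (fct f t) = subst (g ∘ f) t := by
  induction t generalizing Y Z with
  | var x => rfl
  | app t u iht ihu => simp only [fct, subst, iht, ihu]
  | abs t ih =>
    have h : tcomm g ∘ Option.map f = tcomm (g ∘ f) := by
      funext a
      cases a <;> rfl
    simp only [fct, subst, ih, h]

theorem fct_map_shift {X Y : Type u} (f : X → Y) (t : term X) :
    fct (Option.map f) (shift t) = shift (fct f t) := by
  rw [shift, shift, fct_fct, fct_fct]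
  rfl

theorem fct_subst {X Y Z : Type u} (f : X → term Y) (g : Y → Z) (t : term X) :
    fct g (subst f t) = subst (fct g ∘ f) t := by
  induction t generalizing Y Z with
  | var x => rfl
  | app t u iht ihu => simp only [fct, subst, iht, ihu]
  | abs t ih =>
    have h : fct (Option.map g) ∘ tcomm f = tcomm (fct g ∘ f) := by
      funext a
      cases a with
      | none => rfl
      | some a => exact fct_map_shift g (f a)
    simp only [fct, subst, ih, h]

theorem subst_var {X : Type u} (t : term X) : subst term.var t = t := by
  induction t with
  | var x => rfl
  | app t u iht ihu => simp only [subst, iht, ihu]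
  | @abs X t ih =>
    have h : tcomm (term.var : X → term X) = term.var := by
      funext a
      cases a <;> rfl
    rw [subst, h, ih]

theorem fct_subst_sub1 {X Y : Type u} (f : X → Y) (t : term (Option X)) (u : term X) :
    fct f (subst (sub1 u) t) = subst (sub1 (fct f u)) (fct (Option.map f) t) := by
  rw [fct_subst, subst_fct]
  congr 1
  funext a
  cases a <;> rfl

theorem lcr.fct {X Y : Type u} (f : X → Y) {t u : term X} (h : lcr t u) :
    lcr (fct f t) (fct f u) := by
  induction h generalizing Y with
  | var a => exact .var _
  | app _ _ iht ihu => exact .app (iht f) (ihu f)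
  | abs _ ih => exact .abs (ih _)
  | beta t u =>
    rw [fct_subst_sub1]
    exact .beta _ _
  | eta t =>
    simp only [_root_.fct, fct_map_shift]
    exact .eta _
  | sym _ ih => exact .sym (ih f)
  | trans _ _ iht ihu => exact .trans (iht f) (ihu f)

theorem lcr.app1 {X : Type u} {t u : term X} (h : lcr t u) : lcr (app1 t) (app1 u) :=
  .app (h.fct some) (.var none)

theorem subst_tcomm_app1 {X Y : Type u} (f : X → term Y) (t : term X) :
    subst (tcomm f) (app1 t) = app1 (subst f t) := by
  simp only [app1, subst, shift, subst_fct, fct_subst]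
  rfl

theorem lcr_app1_abs {X : Type u} (t : term (Option X)) : lcr (app1 (term.abs t)) t := by
  have h : subst (sub1 (.var none)) (fct (Option.map some) t) = t := by
    rw [subst_fct]
    have hv : sub1 (.var none) ∘ Option.map some = (term.var : Option X → _) := by
      funext a
      cases a <;> rfl
    rw [hv, subst_var]
  have hb := lcr.beta (fct (Option.map some) t) (.var none)
  rw [h] at hb
  exact hb

/-- Abstraction is a linear isomorphism for the semantic
λ-calculus: `abs (app1 x) ≡ x` (η) and `app1 (abs t) ≡ t` (β); hence the
induced maps `abs̄ : Λ(Option X) → Λ X` and `app1̄ : Λ X → Λ(Option X)` are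
mutually inverse bijections, and both are Λ-linear, so `abs̄` is an
isomorphism of left Λ-modules from the derived module `Λ'` to `Λ`. -/
theorem abs_is_linear_iso :
    -- the η-rule and the module-theoretic β-rule
    (∀ (X : Type u) (x : term X), lcr (term.abs (app1 x)) x) ∧
    (∀ (X : Type u) (t : term (Option X)), lcr (app1 (term.abs t)) t) ∧
    -- both `abs` and `app1` are linear (up to βη):
    (∀ (X Y : Type u) (f : X → term Y) (t : term (Option X)),
      lcr (term.abs (subst (tcomm f) t)) (subst f (term.abs t))) ∧
    (∀ (X Y : Type u) (f : X → term Y) (x : term X),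
      lcr (app1 (subst f x)) (subst (tcomm f) (app1 x))) ∧
    -- the induced maps on the quotients are mutually inverse bijections:
    (∃ absBar : ∀ X : Type u, Lam (Option X) → Lam X,
     ∃ app1Bar : ∀ X : Type u, Lam X → Lam (Option X),
      (∀ (X : Type u) (t : term (Option X)), absBar X (lmk t) = lmk (term.abs t)) ∧
      (∀ (X : Type u) (x : term X), app1Bar X (lmk x) = lmk (app1 x)) ∧
      (∀ (X : Type u) (x : Lam X), absBar X (app1Bar X x) = x) ∧
      (∀ (X : Type u) (t : Lam (Option X)), app1Bar X (absBar X t) = t) ∧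
      (∀ X : Type u, Function.Bijective (absBar X)) ∧
      (∀ X : Type u, Function.Bijective (app1Bar X))) := by
  refine ⟨fun _ => .eta, fun _ => lcr_app1_abs, fun _ _ _ _ => .refl _,
    fun _ _ f x => subst_tcomm_app1 f x ▸ .refl _, ?_⟩
  let absBar (X : Type u) : Lam (Option X) → Lam X := Quot.map term.abs fun _ _ => .abs
  let app1Bar (X : Type u) : Lam X → Lam (Option X) := Quot.map app1 fun _ _ => .app1
  have h_eta (X : Type u) : Function.RightInverse (app1Bar X) (absBar X) := by
    intro x
    induction x using Quot.ind with
    | mk x => exact Quot.sound (.eta x)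
  have h_beta (X : Type u) : Function.LeftInverse (app1Bar X) (absBar X) := by
    intro t
    induction t using Quot.ind with
    | mk t => exact Quot.sound (lcr_app1_abs t)
  exact ⟨absBar, app1Bar, fun _ _ => rfl, fun _ _ => rfl, h_eta, h_beta,
    fun X => ⟨(h_beta X).injective, (h_eta X).surjective⟩,
    fun X => ⟨Function.LeftInverse.injective (h_eta X), (h_beta X).surjective⟩⟩
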